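/- Define F(s) = ζ(s) - ψ(1-s) for real s ∈ (0,1). Then F is strictly convex on (0,1), i.e., F''(s) > 0 for all s ∈ (0,1). -/

import Mathlib

/-- The real digamma function `ψ = Γ'/Γ`. -/
noncomputable def digammaReal (x : ℝ) : ℝ := deriv Real.Gamma x / Real.Gamma x

/-- `F(s) = ζ(s) - ψ(1-s)` for real `s`. -/
noncomputable def F (s : ℝ) : ℝ := (riemannZeta s).re - digammaReal (1 - s)

open Set Filter Topology MeasureTheory

theorem convexOn_of_tendsto_pointwise {D : Set ℝ} {f : ℕ → ℝ → ℝ} {g : ℝ → ℝ}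
    (hD : Convex ℝ D) (hf : ∀ n, ConvexOn ℝ D (f n))
    (hlim : ∀ x ∈ D, Tendsto (fun n ↦ f n x) atTop (𝓝 (g x))) : ConvexOn ℝ D g := by
  refine ⟨hD, fun x hx y hy a b ha hb hab ↦ ?_⟩
  exact le_of_tendsto_of_tendsto' (hlim _ (hD hx hy ha hb hab))
    (((hlim x hx).const_smul a).add ((hlim y hy).const_smul b))
    fun n ↦ (hf n).2 hx hy ha hb hab

/-- An analytic function that differs by a convex function from one with positive second
derivative has positive second derivative. -/
theorem deriv_deriv_pos_of_convexOn_sub {a b : ℝ} {f p p' p'' : ℝ → ℝ}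
    (hf : AnalyticOnNhd ℝ f (Ioo a b))
    (hp : ∀ x ∈ Ioo a b, HasDerivAt p (p' x) x) (hp' : ∀ x ∈ Ioo a b, HasDerivAt p' (p'' x) x)
    (hpos : ∀ x ∈ Ioo a b, 0 < p'' x) (hconv : ConvexOn ℝ (Ioo a b) (fun x ↦ f x - p x)) :
    ∀ x ∈ Ioo a b, 0 < deriv (deriv f) x := by
  intro x hx
  have hd : ∀ y ∈ Ioo a b, HasDerivAt (fun x ↦ f x - p x) (deriv f y - p' y) y := fun y hy ↦
    (hf y hy).differentiableAt.hasDerivAt.sub (hp y hy)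
  have hmono := hconv.monotoneOn_deriv fun y hy ↦ (hd y hy).differentiableAt
  have hdd : HasDerivAt (fun y ↦ deriv f y - p' y) (deriv (deriv f) x - p'' x) x :=
    (hf x hx).deriv.differentiableAt.hasDerivAt.sub (hp' x hx)
  have hev : deriv (fun x ↦ f x - p x) =ᶠ[𝓝 x] fun y ↦ deriv f y - p' y := by
    filter_upwards [isOpen_Ioo.mem_nhds hx] with y hy using (hd y hy).deriv
  have hnn := hmono.derivWithin_nonneg (x := x)
  rw [derivWithin_of_isOpen isOpen_Ioo hx, hev.deriv_eq, hdd.deriv] at hnn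
  linarith [hpos x hx]

theorem analyticAt_realGamma {x : ℝ} (hx : 0 < x) : AnalyticAt ℝ Real.Gamma x := by
  have h : AnalyticAt ℂ Complex.Gamma (x : ℂ) := by
    refine DifferentiableOn.analyticAt (s := {z | 0 < z.re}) (fun z hz ↦ ?_)
      ((isOpen_lt continuous_const Complex.continuous_re).mem_nhds (by simpa using hx))
    refine (Complex.differentiableAt_Gamma z fun m hm ↦ ?_).differentiableWithinAt
    have : 0 < z.re := hz
    rw [hm] at this
    simp only [Complex.neg_re, Complex.natCast_re] at this
    linarith [(Nat.cast_nonneg m : (0 : ℝ) ≤ m)]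
  exact h.re_ofReal

theorem analyticAt_digammaReal {x : ℝ} (hx : 0 < x) : AnalyticAt ℝ digammaReal x :=
  (analyticAt_realGamma hx).deriv.div (analyticAt_realGamma hx) (Real.Gamma_pos_of_pos hx).ne'

theorem digammaReal_add_one {x : ℝ} (hx : 0 < x) :
    digammaReal (x + 1) = digammaReal x + 1 / x := by
  have hG := (Real.Gamma_pos_of_pos hx).ne'
  have h1 : HasDerivAt (fun y ↦ Real.Gamma (y + 1)) (deriv Real.Gamma (x + 1)) x :=
    HasDerivAt.comp_add_const x 1
      (analyticAt_realGamma (by linarith : 0 < x + 1)).differentiableAt.hasDerivAt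
  have h2 : HasDerivAt (fun y ↦ y * Real.Gamma y) (1 * Real.Gamma x + x * deriv Real.Gamma x) x :=
    (hasDerivAt_id x).mul (analyticAt_realGamma hx).differentiableAt.hasDerivAt
  have hev : (fun y ↦ Real.Gamma (y + 1)) =ᶠ[𝓝 x] fun y ↦ y * Real.Gamma y := by
    filter_upwards [isOpen_Ioi.mem_nhds hx] with y hy using Real.Gamma_add_one (ne_of_gt hy)
  have h3 := h1.unique (h2.congr_of_eventuallyEq hev)
  rw [digammaReal, digammaReal, h3, Real.Gamma_add_one hx.ne']
  field_simp
  ring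

theorem digammaReal_add_nat {x : ℝ} (hx : 0 < x) (n : ℕ) :
    digammaReal (x + n) = digammaReal x + ∑ k ∈ Finset.range n, 1 / (x + k) := by
  induction n with
  | zero => simp
  | succ n ih =>
    rw [Finset.sum_range_succ, ← add_assoc, ← ih, ← digammaReal_add_one (by positivity)]
    push_cast
    ring_nf

theorem deriv_log_comp_Gamma {x : ℝ} (hx : 0 < x) :
    HasDerivAt (Real.log ∘ Real.Gamma) (digammaReal x) x :=
  (analyticAt_realGamma hx).differentiableAt.hasDerivAt.log (Real.Gamma_pos_of_pos hx).ne'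

theorem slope_log_comp_Gamma {x : ℝ} (hx : 0 < x) :
    slope (Real.log ∘ Real.Gamma) x (x + 1) = Real.log x := by
  rw [slope_def_field, Function.comp_apply, Function.comp_apply, Real.Gamma_add_one hx.ne',
    Real.log_mul hx.ne' (Real.Gamma_pos_of_pos hx).ne']
  ring

theorem digammaReal_le_log {x : ℝ} (hx : 0 < x) : digammaReal x ≤ Real.log x := by
  rw [← slope_log_comp_Gamma hx]
  exact Real.convexOn_log_Gamma.le_slope_of_hasDerivAt hx (by simp; linarith) (by linarith)
    (deriv_log_comp_Gamma hx)

theorem log_le_digammaReal_add_one {x : ℝ} (hx : 0 < x) :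
    Real.log x ≤ digammaReal (x + 1) := by
  rw [← slope_log_comp_Gamma hx]
  exact Real.convexOn_log_Gamma.slope_le_of_hasDerivAt hx (by simp; linarith) (by linarith)
    (deriv_log_comp_Gamma (by linarith))

theorem tendsto_digammaReal_add_nat_sub_log {x : ℝ} (hx : 0 < x) :
    Tendsto (fun n : ℕ ↦ digammaReal (x + n) - Real.log n) atTop (𝓝 0) := by
  have key (y : ℝ) : Tendsto (fun n : ℕ ↦ Real.log (n + y) - Real.log n) atTop (𝓝 0) :=
    (Real.tendsto_log_comp_add_sub_log y).comp tendsto_natCast_atTop_atTop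
  refine tendsto_of_tendsto_of_tendsto_of_le_of_le' (key (x - 1)) (key x) ?_ ?_
  · filter_upwards [eventually_ge_atTop 1] with n hn
    have hn' : (1 : ℝ) ≤ n := by exact_mod_cast hn
    have := log_le_digammaReal_add_one (x := n + (x - 1)) (by linarith)
    rw [show (n : ℝ) + (x - 1) + 1 = x + n by ring] at this
    linarith
  · filter_upwards with n
    have := digammaReal_le_log (x := x + n) (by positivity)
    rw [add_comm (n : ℝ) x]
    linarith

theorem convexOn_neg_digammaReal : ConvexOn ℝ (Ioi 0) (fun x ↦ -digammaReal x) := by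
  refine convexOn_of_tendsto_pointwise (convex_Ioi 0)
    (f := fun n x ↦ (∑ k ∈ Finset.range n, 1 / (x + k)) + -Real.log n) (fun n ↦ ?_) fun x hx ↦ ?_
  · refine ConvexOn.add ?_ (convexOn_const _ (convex_Ioi 0))
    induction n with
    | zero => simpa using convexOn_const (0 : ℝ) (convex_Ioi (0 : ℝ))
    | succ n ih =>
      simp only [Finset.sum_range_succ]
      refine ih.add ?_
      have h := (convexOn_zpow (𝕜 := ℝ) (-1)).translate_left (n : ℝ)
      refine (h.subset (fun y hy ↦ ?_) (convex_Ioi 0)).congr fun y hy ↦ ?_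
      · have : (0 : ℝ) < y := hy
        simp only [mem_preimage, mem_Ioi]
        positivity
      · simp
  · have h := (tendsto_digammaReal_add_nat_sub_log hx).const_add (-digammaReal x)
    rw [add_zero] at h
    refine h.congr fun n ↦ ?_
    rw [digammaReal_add_nat hx]
    ring

/-- The kernel `{t}(1 - {t}) / 2` of the trapezoidal rule on `[n, n + 1]`. -/
noncomputable def trapezoidKernel (t : ℝ) : ℝ := Int.fract t * (1 - Int.fract t) / 2

theorem continuous_trapezoidKernel : Continuous trapezoidKernel :=
  ContinuousOn.comp_fract'' (f := fun x : ℝ ↦ x * (1 - x) / 2) (by fun_prop) (by simp)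

theorem trapezoidKernel_nonneg (t : ℝ) : 0 ≤ trapezoidKernel t := by
  have h0 := Int.fract_nonneg t
  have h1 := (Int.fract_lt_one t).le
  unfold trapezoidKernel
  have := mul_nonneg h0 (sub_nonneg.2 h1)
  linarith

theorem trapezoidKernel_le (t : ℝ) : trapezoidKernel t ≤ 1 / 8 := by
  unfold trapezoidKernel
  nlinarith [sq_nonneg (Int.fract t - 1 / 2)]

theorem trapezoidKernel_eq {n : ℕ} {t : ℝ} (ht : t ∈ Icc (n : ℝ) (n + 1)) :
    trapezoidKernel t = (t - n) * (1 - (t - n)) / 2 := by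
  rcases eq_or_lt_of_le ht.2 with h | h
  · have : Int.fract t = 0 := by
      rw [h]
      exact_mod_cast Int.fract_natCast (R := ℝ) (n + 1)
    rw [trapezoidKernel, this, h]
    ring
  · have : Int.fract t = t - n := by
      rw [Int.fract_eq_iff]
      exact ⟨by linarith [ht.1], by linarith, n, by push_cast; ring⟩
    rw [trapezoidKernel, this]

/-- The trapezoidal rule with remainder for `x ↦ x ^ (-s)` on `[n, n + 1]`. -/
theorem integral_trapezoidKernel_mul_rpow {n : ℕ} (hn : 0 < n) {s : ℝ} (hs : s ≠ 1) :
    ∫ x in (n : ℝ)..(n + 1), trapezoidKernel x * (s * (s + 1) * x ^ (-s - 2)) =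
      ((n : ℝ) ^ (-s) + ((n : ℝ) + 1) ^ (-s)) / 2 +
        (((n : ℝ) + 1) ^ (1 - s) - (n : ℝ) ^ (1 - s)) / (s - 1) := by
  have hn0 : (0 : ℝ) < n := by exact_mod_cast hn
  have hle : (n : ℝ) ≤ n + 1 := by linarith
  have hs1 : s - 1 ≠ 0 := sub_ne_zero.2 hs
  have h1 : ∫ x in (n : ℝ)..(n + 1), trapezoidKernel x * (s * (s + 1) * x ^ (-s - 2)) =
      ∫ x in (n : ℝ)..(n + 1), (x - n) * (1 - (x - n)) / 2 * (s * (s + 1) * x ^ (-s - 2)) := by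
    refine intervalIntegral.integral_congr fun x hx ↦ ?_
    rw [uIcc_of_le hle] at hx
    simp only [trapezoidKernel_eq hx]
  have hpos : ∀ x ∈ uIcc (n : ℝ) (n + 1), 0 < x := fun x hx ↦ by
    rw [uIcc_of_le hle] at hx
    exact hn0.trans_le hx.1
  rw [h1, intervalIntegral.integral_eq_sub_of_hasDerivAt
    (f := fun x ↦ (x - n) * (1 - (x - n)) / 2 * (-s * x ^ (-s - 1)) -
      (1 / 2 - (x - n)) * x ^ (-s) - x ^ (1 - s) / (1 - s))]
  · simp only [sub_self, add_sub_cancel_left]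
    have : 1 - s ≠ 0 := fun h ↦ hs1 (by linarith)
    field_simp
    ring
  · intro x hx
    have hx0 := hpos x hx
    have d1 : HasDerivAt (fun x : ℝ ↦ x ^ (-s - 1)) ((-s - 1) * x ^ (-s - 2)) x := by
      convert Real.hasDerivAt_rpow_const (p := -s - 1) (Or.inl hx0.ne') using 2
      ring_nf
    have d2 : HasDerivAt (fun x : ℝ ↦ x ^ (-s)) (-s * x ^ (-s - 1)) x :=
      Real.hasDerivAt_rpow_const (Or.inl hx0.ne')
    have d3 : HasDerivAt (fun x : ℝ ↦ x ^ (1 - s)) ((1 - s) * x ^ (-s)) x := by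
      convert Real.hasDerivAt_rpow_const (p := 1 - s) (Or.inl hx0.ne') using 2
      ring_nf
    have d4 : HasDerivAt (fun x : ℝ ↦ x - n) 1 x := (hasDerivAt_id x).sub_const _
    have d5 := (((d4.mul (d4.const_sub 1)).div_const 2).mul (d1.const_mul (-s))).sub
      ((d4.const_sub (1 / 2)).mul d2) |>.sub (d3.div_const (1 - s))
    refine d5.congr_deriv ?_
    have : 1 - s ≠ 0 := fun h ↦ hs1 (by linarith)
    simp only [Pi.mul_apply]
    field_simp
    ring
  · refine ContinuousOn.intervalIntegrable fun x hx ↦ ContinuousAt.continuousWithinAt ?_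
    exact (by fun_prop : ContinuousAt (fun x : ℝ ↦ (x - n) * (1 - (x - n)) / 2) x).mul
      (continuousAt_const.mul (Real.continuousAt_rpow_const _ _ (Or.inl (hpos x hx).ne')))

theorem integrableOn_trapezoidKernel_mul_rpow {s : ℝ} (hs : 0 < s) :
    IntegrableOn (fun x ↦ trapezoidKernel x * (s * (s + 1) * x ^ (-s - 2))) (Ioi 1) := by
  have h := (integrableOn_Ioi_rpow_of_lt (by linarith : -s - 2 < -1) one_pos).const_mul
    (s * (s + 1))
  refine Integrable.bdd_mul (c := 1 / 8) h continuous_trapezoidKernel.aestronglyMeasurable ?_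
  filter_upwards with x
  rw [Real.norm_of_nonneg (trapezoidKernel_nonneg x)]
  exact trapezoidKernel_le x

theorem riemannZeta_eq_integral_of_one_lt {s : ℝ} (hs : 1 < s) :
    riemannZeta s = ((1 / 2 + 1 / (s - 1) +
      ∫ x in Ioi (1 : ℝ), trapezoidKernel x * (s * (s + 1) * x ^ (-s - 2)) : ℝ) : ℂ) := by
  have hz : riemannZeta s = ((∑' n : ℕ, ((n : ℝ) + 1) ^ (-s) : ℝ) : ℂ) := by
    rw [zeta_eq_tsum_one_div_nat_add_one_cpow (by simpa using hs), Complex.ofReal_tsum]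
    congr 1 with n
    rw [Real.rpow_neg (by positivity), Complex.ofReal_inv, Complex.ofReal_cpow (by positivity)]
    simp
  rw [hz]
  congr 1
  have hsum : Summable fun n : ℕ ↦ ((n : ℝ) + 1) ^ (-s) := by
    have := (summable_nat_add_iff 1).2 (Real.summable_nat_rpow.2 (by linarith : -s < -1))
    simpa using this
  have hI := integrableOn_trapezoidKernel_mul_rpow (by linarith : 0 < s)
  have hpart (N : ℕ) : ∫ x in (1 : ℝ)..(N + 1), trapezoidKernel x * (s * (s + 1) * x ^ (-s - 2)) =
      (∑ n ∈ Finset.range N, ((n : ℝ) + 1) ^ (-s)) - 1 / 2 + ((N : ℝ) + 1) ^ (-s) / 2 +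
        (((N : ℝ) + 1) ^ (1 - s) - 1) / (s - 1) := by
    induction N with
    | zero => simp
    | succ N ih =>
      have hN := integral_trapezoidKernel_mul_rpow N.succ_pos hs.ne'
      have hii (a b : ℝ) (ha : 1 ≤ a) (hab : a ≤ b) : IntervalIntegrable
          (fun x ↦ trapezoidKernel x * (s * (s + 1) * x ^ (-s - 2))) volume a b :=
        (intervalIntegrable_iff_integrableOn_Ioc_of_le hab).2
          (hI.mono_set fun x hx ↦ lt_of_le_of_lt ha hx.1)
      have hN0 : (0 : ℝ) ≤ N := N.cast_nonneg
      push_cast at hN ⊢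
      rw [← intervalIntegral.integral_add_adjacent_intervals
        (hii 1 (N + 1) le_rfl (by linarith)) (hii (N + 1) (N + 1 + 1) (by linarith) (by linarith)),
        ih, hN, Finset.sum_range_succ]
      ring
  have hcast : Tendsto (fun N : ℕ ↦ (N : ℝ) + 1) atTop atTop :=
    tendsto_atTop_add_const_right _ _ tendsto_natCast_atTop_atTop
  have hlim1 := intervalIntegral_tendsto_integral_Ioi 1 hI hcast
  simp only [hpart] at hlim1
  have t1 := (tendsto_rpow_neg_atTop (by linarith : 0 < s)).comp hcast
  have t2 : Tendsto (fun N : ℕ ↦ ((N : ℝ) + 1) ^ (1 - s)) atTop (𝓝 0) := by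
    have := (tendsto_rpow_neg_atTop (by linarith : 0 < s - 1)).comp hcast
    simpa only [Function.comp_def, neg_sub] using this
  have hlim2 := ((hsum.hasSum.tendsto_sum_nat.sub_const (1 / 2)).add (t1.div_const 2)).add
    ((t2.sub_const 1).div_const (s - 1))
  have := tendsto_nhds_unique hlim1 hlim2
  rw [this]
  ring

/-- The trapezoid kernel on `(1, ∞)`, extended by zero. -/
noncomputable def truncatedKernel : ℝ → ℂ :=
  (Ioi (1 : ℝ)).indicator fun t ↦ (trapezoidKernel t : ℂ)

theorem norm_truncatedKernel_le (t : ℝ) : ‖truncatedKernel t‖ ≤ 1 / 8 := by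
  refine (norm_indicator_le_norm_self _ _).trans ?_
  rw [Complex.norm_of_nonneg (trapezoidKernel_nonneg t)]
  exact trapezoidKernel_le t

theorem differentiableAt_mellin_truncatedKernel {z : ℂ} (hz : z.re < 0) :
    DifferentiableAt ℂ (mellin truncatedKernel) z := by
  have hmeas : Measurable truncatedKernel :=
    (Complex.measurable_ofReal.comp continuous_trapezoidKernel.measurable).indicator
      measurableSet_Ioi
  refine mellin_differentiableAt_of_isBigO_rpow (a := 0) (b := z.re - 1) ?_ ?_ hz ?_ (by linarith)
  · have hc : LocallyIntegrable (fun _ : ℝ ↦ (1 / 8 : ℝ)) := locallyIntegrable_const _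
    refine (hc.mono hmeas.aestronglyMeasurable ?_).locallyIntegrableOn _
    filter_upwards with t
    simpa using norm_truncatedKernel_le t
  · refine Asymptotics.IsBigO.of_bound (1 / 8) ?_
    filter_upwards with t
    simpa using norm_truncatedKernel_le t
  · refine Asymptotics.IsBigO.of_bound 1 ?_
    filter_upwards [Ioo_mem_nhdsGT (one_pos (α := ℝ))] with t ht
    rw [truncatedKernel, indicator_of_notMem (by simpa using ht.2.le)]
    simp

theorem mellin_truncatedKernel (s : ℝ) :
    (s * (s + 1) : ℂ) * mellin truncatedKernel (-s - 1) =
      ((∫ x in Ioi (1 : ℝ), trapezoidKernel x * (s * (s + 1) * x ^ (-s - 2)) : ℝ) : ℂ) := by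
  have h : ∀ t : ℝ, (t : ℂ) ^ ((-s - 1 : ℂ) - 1) • truncatedKernel t =
      (Ioi (1 : ℝ)).indicator (fun t ↦ (t : ℂ) ^ ((-s - 1 : ℂ) - 1) * trapezoidKernel t) t :=
    fun t ↦ by by_cases ht : t ∈ Ioi (1 : ℝ) <;> simp [truncatedKernel, ht]
  rw [mellin]
  simp only [h]
  rw [setIntegral_indicator measurableSet_Ioi, inter_eq_self_of_subset_right
    (Ioi_subset_Ioi zero_le_one), ← integral_complex_ofReal, ← integral_const_mul]
  refine setIntegral_congr_fun measurableSet_Ioi fun t ht ↦ ?_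
  have ht0 : (0 : ℝ) ≤ t := zero_le_one.trans (le_of_lt ht)
  simp only [Complex.ofReal_mul, Complex.ofReal_cpow ht0]
  push_cast
  rw [show (-s - 1 - 1 : ℂ) = -s - 2 by ring]
  ring

theorem riemannZeta_eq_mellin {s : ℂ} (hs : 0 < s.re) (hs1 : s ≠ 1) :
    riemannZeta s =
      1 / 2 + 1 / (s - 1) + s * (s + 1) * mellin truncatedKernel (-s - 1) := by
  set U : Set ℂ := {z | 0 < z.re}
  have hU : IsOpen U := isOpen_lt continuous_const Complex.continuous_re
  have hne : ∀ z ∈ U, z ≠ 0 := fun z hz h ↦ by simp [U, h] at hz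
  let A : ℂ → ℂ := fun z ↦
    ((1 - z) * completedRiemannZeta₀ z - (1 - z) / z - 1) * (z.Gammaℝ)⁻¹
  let B : ℂ → ℂ := fun z ↦
    (1 - z) / 2 - 1 + (1 - z) * (z * (z + 1) * mellin truncatedKernel (-z - 1))
  have hA : ∀ z ∈ U, z ≠ 1 → A z = (1 - z) * riemannZeta z := fun z hz hz1 ↦ by
    have h0 := hne z hz
    have h1 : 1 - z ≠ 0 := sub_ne_zero.2 (Ne.symm hz1)
    simp only [A]
    rw [riemannZeta_def_of_ne_zero h0, completedRiemannZeta_eq, div_eq_mul_inv _ z.Gammaℝ]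
    field_simp
  have hAd : AnalyticOnNhd ℂ A U := by
    refine DifferentiableOn.analyticOnNhd (fun z hz ↦ DifferentiableAt.differentiableWithinAt ?_) hU
    have h1 : DifferentiableAt ℂ (fun z : ℂ ↦ 1 - z) z := by fun_prop
    exact (((h1.mul (differentiable_completedZeta₀ z)).sub
      (h1.div differentiableAt_id (hne z hz))).sub_const 1).mul (Complex.differentiable_Gammaℝ_inv z)
  have hBd : AnalyticOnNhd ℂ B U := by
    refine DifferentiableOn.analyticOnNhd (fun z hz ↦ DifferentiableAt.differentiableWithinAt ?_) hU
    have hz' : 0 < z.re := hz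
    have hM : DifferentiableAt ℂ (fun z : ℂ ↦ mellin truncatedKernel (-z - 1)) z := by
      have hre : (-z - 1).re < 0 := by
        simp only [Complex.sub_re, Complex.neg_re, Complex.one_re]
        linarith
      exact DifferentiableAt.comp (g := mellin truncatedKernel) (f := fun z : ℂ ↦ -z - 1) z
        (differentiableAt_mellin_truncatedKernel hre) (by fun_prop)
    simp only [B]
    fun_prop
  have hfreq : ∃ᶠ z in 𝓝[≠] (2 : ℂ), A z = B z := by
    have hr : ∃ᶠ x : ℝ in 𝓝[≠] (2 : ℝ), A x = B x := by
      refine Eventually.frequently ?_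
      filter_upwards [nhdsWithin_le_nhds (isOpen_Ioi.mem_nhds (by norm_num : (1 : ℝ) < 2))]
        with x hx
      have hx1 : (1 : ℝ) < x := hx
      have hxne : (x : ℂ) ≠ 1 := by exact_mod_cast hx1.ne'
      have hxne' : (x : ℂ) - 1 ≠ 0 := sub_ne_zero.2 hxne
      rw [hA x (by simp only [U, mem_ofPred_eq, Complex.ofReal_re]; linarith) hxne,
        riemannZeta_eq_integral_of_one_lt hx1]
      simp only [B]
      rw [mellin_truncatedKernel, Complex.ofReal_add]
      generalize (∫ x in Ioi (1 : ℝ), _ : ℝ) = I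
      push_cast
      field_simp
      ring
    rw [frequently_iff_seq_forall] at hr ⊢
    obtain ⟨u, hu, hu'⟩ := hr
    refine ⟨fun n ↦ u n, ?_, hu'⟩
    rw [tendsto_nhdsWithin_iff] at hu ⊢
    refine ⟨?_, ?_⟩
    · exact_mod_cast (Complex.continuous_ofReal.tendsto 2).comp hu.1
    · filter_upwards [hu.2] with n hn
      simp only [mem_compl_iff, mem_singleton_iff] at hn ⊢
      exact_mod_cast hn
  have hEq := hAd.eqOn_of_preconnected_of_frequently_eq hBd
    (convex_halfSpace_re_gt 0).isPreconnected (by simp [U]) hfreq hs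
  rw [hA s hs hs1] at hEq
  have h1 : 1 - s ≠ 0 := sub_ne_zero.2 (Ne.symm hs1)
  have h2 : s - 1 ≠ 0 := sub_ne_zero.2 hs1
  refine mul_left_cancel₀ h1 (hEq.trans ?_)
  simp only [B]
  field_simp
  ring

theorem re_riemannZeta_eq_integral {s : ℝ} (hs : 0 < s) (hs1 : s ≠ 1) :
    (riemannZeta s).re = 1 / 2 + 1 / (s - 1) +
      ∫ x in Ioi (1 : ℝ), trapezoidKernel x * (s * (s + 1) * x ^ (-s - 2)) := by
  rw [riemannZeta_eq_mellin (by simpa using hs) (by exact_mod_cast hs1), mellin_truncatedKernel]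
  generalize (∫ x in Ioi (1 : ℝ), _ : ℝ) = I
  rw [show (1 / 2 + 1 / (s - 1) + I : ℂ) = ((1 / 2 + 1 / (s - 1) + I : ℝ) : ℂ) by push_cast; rfl,
    Complex.ofReal_re]

theorem convexOn_mul_exp_neg_add_sq {u : ℝ} (hu : 0 ≤ u) :
    ConvexOn ℝ (Ioo 0 1) fun s ↦
      s * (s + 1) * Real.exp (-(u * s)) + (2 * u + 1 / 2) * (s ^ 2 / 2) := by
  have he (s : ℝ) : HasDerivAt (fun s ↦ Real.exp (-(u * s))) (-u * Real.exp (-(u * s))) s := by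
    have h : HasDerivAt (fun s ↦ -(u * s)) (-u) s := by
      simpa using ((hasDerivAt_id s).const_mul u).fun_neg
    exact h.exp.congr_deriv (by ring)
  refine convexOn_of_hasDerivWithinAt2_nonneg (convex_Ioo 0 1) (by fun_prop)
    (f' := fun s ↦ (2 * s + 1 - u * (s * (s + 1))) * Real.exp (-(u * s)) + (2 * u + 1 / 2) * s)
    (f'' := fun s ↦ ((2 - u * (2 * s + 1)) - u * (2 * s + 1 - u * (s * (s + 1)))) *
      Real.exp (-(u * s)) + (2 * u + 1 / 2)) ?_ ?_ ?_
  · intro s _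
    have h1 : HasDerivAt (fun s : ℝ ↦ s * (s + 1)) (2 * s + 1) s := by
      refine ((hasDerivAt_id s).mul ((hasDerivAt_id s).add_const 1)).congr_deriv ?_
      simp
      ring
    have h2 : HasDerivAt (fun s : ℝ ↦ s ^ 2 / 2) s s := by
      refine ((hasDerivAt_pow 2 s).div_const 2).congr_deriv ?_
      simp
    refine (((h1.mul (he s)).add (h2.const_mul _)).congr_deriv ?_).hasDerivWithinAt
    ring
  · intro s _
    have h1 : HasDerivAt (fun s : ℝ ↦ s * (s + 1)) (2 * s + 1) s := by
      refine ((hasDerivAt_id s).mul ((hasDerivAt_id s).add_const 1)).congr_deriv ?_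
      simp
      ring
    have h3 : HasDerivAt (fun s : ℝ ↦ 2 * s + 1) 2 s := by
      simpa using ((hasDerivAt_id s).const_mul 2).add_const 1
    refine ((((h3.sub (h1.const_mul u)).mul (he s)).add
      ((hasDerivAt_id s).const_mul _)).congr_deriv ?_).hasDerivWithinAt
    simp only [Pi.sub_apply]
    ring
  · intro s hs
    rw [interior_Ioo] at hs
    set v := u * s with hv
    have hv0 : 0 ≤ v := mul_nonneg hu hs.1.le
    have hexp := Real.quadratic_le_exp_of_nonneg hv0
    have hE : Real.exp (-v) * Real.exp v = 1 := by rw [← Real.exp_add]; simp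
    have hkey : 0 ≤ (2 - u * (2 * s + 1)) - u * (2 * s + 1 - u * (s * (s + 1))) +
        (2 * u + 1 / 2) * Real.exp v := by
      have h1 : (2 * u + 1 / 2) * (1 + v + v ^ 2 / 2) ≤ (2 * u + 1 / 2) * Real.exp v :=
        mul_le_mul_of_nonneg_left hexp (by linarith)
      have h2 : (2 - u * (2 * s + 1)) - u * (2 * s + 1 - u * (s * (s + 1))) =
          2 - 4 * v + v ^ 2 + u * (v - 2) := by rw [hv]; ring
      rw [h2]
      have h3 : 0 ≤ u * v := mul_nonneg hu hv0
      have h4 : 0 ≤ u * v ^ 2 := mul_nonneg hu (sq_nonneg v)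
      nlinarith [sq_nonneg (v - 7 / 5)]
    have := mul_nonneg (Real.exp_pos (-v)).le hkey
    linear_combination this + (2 * u + 1 / 2) * hE

theorem hasDerivAt_neg_two_mul_log_add_div {x : ℝ} (hx : 0 < x) :
    HasDerivAt (fun x ↦ -(2 * Real.log x + 5 / 2) / x)
      ((2 * Real.log x + 1 / 2) * x ^ (-2 : ℝ)) x := by
  have h := ((((Real.hasDerivAt_log hx.ne').const_mul 2).add_const (5 / 2)).neg).div
    (hasDerivAt_id x) hx.ne'
  refine h.congr_deriv ?_
  rw [show (-2 : ℝ) = ((-2 : ℤ) : ℝ) by norm_num, Real.rpow_intCast, zpow_neg]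
  simp only [id, Pi.neg_apply]
  field_simp
  norm_cast
  ring

theorem tendsto_neg_two_mul_log_add_div :
    Tendsto (fun x : ℝ ↦ -(2 * Real.log x + 5 / 2) / x) atTop (𝓝 0) := by
  have h1 : Tendsto (fun x : ℝ ↦ Real.log x / x) atTop (𝓝 0) :=
    Real.isLittleO_log_id_atTop.tendsto_div_nhds_zero
  have h2 := (h1.const_mul (-2)).add (tendsto_inv_atTop_zero.const_mul (-(5 / 2) : ℝ))
  simp only [mul_zero, add_zero] at h2
  refine h2.congr fun x ↦ ?_
  ring

theorem integrableOn_log_mul_rpow :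
    IntegrableOn (fun x : ℝ ↦ (2 * Real.log x + 1 / 2) * x ^ (-2 : ℝ)) (Ioi 1) :=
  integrableOn_Ioi_deriv_of_nonneg'
    (fun x hx ↦ hasDerivAt_neg_two_mul_log_add_div (one_pos.trans_le hx))
    (fun x hx ↦ mul_nonneg (by linarith [Real.log_nonneg (le_of_lt hx)])
      (Real.rpow_nonneg (zero_le_one.trans (le_of_lt hx)) _)) tendsto_neg_two_mul_log_add_div

theorem integral_log_mul_rpow :
    ∫ x in Ioi (1 : ℝ), (2 * Real.log x + 1 / 2) * x ^ (-2 : ℝ) = 5 / 2 := by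
  rw [integral_Ioi_of_hasDerivAt_of_tendsto'
    (fun x hx ↦ hasDerivAt_neg_two_mul_log_add_div (one_pos.trans_le hx))
    integrableOn_log_mul_rpow tendsto_neg_two_mul_log_add_div]
  simp

theorem convexOn_integral_trapezoidKernel :
    ConvexOn ℝ (Ioo 0 1) fun s ↦
      (∫ x in Ioi (1 : ℝ), trapezoidKernel x * (s * (s + 1) * x ^ (-s - 2))) +
        5 / 32 * s ^ 2 := by
  let g : ℝ → ℝ → ℝ := fun s x ↦ trapezoidKernel x * (s * (s + 1) * x ^ (-s - 2)) +
    s ^ 2 / 16 * ((2 * Real.log x + 1 / 2) * x ^ (-2 : ℝ))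
  have hg_int : ∀ s ∈ Ioo (0 : ℝ) 1, IntegrableOn (g s) (Ioi 1) := fun s hs ↦
    (integrableOn_trapezoidKernel_mul_rpow hs.1).add (integrableOn_log_mul_rpow.const_mul _)
  have hval : ∀ s ∈ Ioo (0 : ℝ) 1, ∫ x in Ioi (1 : ℝ), g s x =
      (∫ x in Ioi (1 : ℝ), trapezoidKernel x * (s * (s + 1) * x ^ (-s - 2))) +
        5 / 32 * s ^ 2 := fun s hs ↦ by
    rw [integral_add (integrableOn_trapezoidKernel_mul_rpow hs.1)
      (integrableOn_log_mul_rpow.const_mul _), integral_const_mul, integral_log_mul_rpow]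
    ring
  have hconv : ∀ x ∈ Ioi (1 : ℝ), ConvexOn ℝ (Ioo 0 1) fun s ↦ g s x := fun x hx ↦ by
    have hx1 : (1 : ℝ) < x := hx
    have hx0 : 0 < x := one_pos.trans hx1
    have hlog := Real.log_nonneg hx1.le
    have hsq : ConvexOn ℝ (Ioo (0 : ℝ) 1) fun s ↦ s ^ 2 :=
      (even_two.convexOn_pow).subset (subset_univ _) (convex_Ioo 0 1)
    have h1 := (convexOn_mul_exp_neg_add_sq hlog).smul
      (mul_nonneg (trapezoidKernel_nonneg x) (Real.rpow_nonneg hx0.le (-2)))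
    have hc : 0 ≤ (1 / 8 - trapezoidKernel x) * ((2 * Real.log x + 1 / 2) * x ^ (-2 : ℝ)) / 2 :=
      div_nonneg (mul_nonneg (by linarith [trapezoidKernel_le x])
        (mul_nonneg (by linarith) (Real.rpow_nonneg hx0.le _))) zero_le_two
    refine (h1.add (hsq.smul hc)).congr fun s _ ↦ ?_
    have hrpow : x ^ (-s - 2) = x ^ (-2 : ℝ) * Real.exp (-(Real.log x * s)) := by
      rw [show -s - 2 = -2 + -s by ring, Real.rpow_add hx0, Real.rpow_def_of_pos hx0 (-s)]
      ring_nf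
    simp only [g, hrpow, smul_eq_mul, Pi.add_apply]
    ring
  refine ConvexOn.congr ?_ hval
  refine ⟨convex_Ioo 0 1, fun s hs t ht a b ha hb hab ↦ ?_⟩
  simp only [smul_eq_mul]
  rw [← integral_const_mul, ← integral_const_mul,
    ← integral_add ((hg_int s hs).const_mul a) ((hg_int t ht).const_mul b)]
  refine setIntegral_mono_on (hg_int _ (convex_Ioo 0 1 hs ht ha hb hab))
    (((hg_int s hs).const_mul a).add ((hg_int t ht).const_mul b)) measurableSet_Ioi fun x hx ↦ ?_
  simpa only [smul_eq_mul] using (hconv x hx).2 hs ht ha hb hab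

theorem F_eq {s : ℝ} (hs : s ∈ Ioo (0 : ℝ) 1) :
    F s = 1 / 2 + (∫ x in Ioi (1 : ℝ), trapezoidKernel x * (s * (s + 1) * x ^ (-s - 2))) +
      1 / (2 - s) + 1 / (3 - s) + -digammaReal (4 - s) := by
  have h := digammaReal_add_nat (x := 1 - s) (by linarith [hs.2]) 3
  rw [show 1 - s + (3 : ℕ) = 4 - s by push_cast; ring] at h
  simp only [Finset.sum_range_succ, Finset.sum_range_zero] at h
  push_cast at h
  rw [F, re_riemannZeta_eq_integral hs.1 hs.2.ne, h, show 1 - s + 1 = 2 - s by ring,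
    show 1 - s + 2 = 3 - s by ring, ← neg_sub 1 s, one_div_neg_eq_neg_one_div]
  ring

theorem analyticOnNhd_F : AnalyticOnNhd ℝ F (Ioo 0 1) := fun s hs ↦ by
  have hz : AnalyticAt ℂ riemannZeta (s : ℂ) :=
    analyticOn_riemannZeta s (by simpa using (by exact_mod_cast hs.2.ne : (s : ℂ) ≠ 1))
  have hd : AnalyticAt ℝ (fun s ↦ digammaReal (1 - s)) s :=
    AnalyticAt.fun_comp (analyticAt_digammaReal (by linarith [hs.2])) (by fun_prop)
  exact hz.re_ofReal.sub hd

theorem deriv_deriv_F_pos : ∀ s ∈ Ioo (0 : ℝ) 1, 0 < deriv (deriv F) s := by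
  have hinv (c x : ℝ) (hx : c - x ≠ 0) :
      HasDerivAt (fun x ↦ 1 / (c - x)) (1 / (c - x) ^ 2) x := by
    simpa using ((hasDerivAt_id x).const_sub c).fun_inv hx
  have hinv2 (c x : ℝ) (hx : c - x ≠ 0) :
      HasDerivAt (fun x ↦ 1 / (c - x) ^ 2) (2 / (c - x) ^ 3) x := by
    have h := (((hasDerivAt_id x).const_sub c).fun_pow 2).fun_inv (pow_ne_zero 2 hx)
    simp only [← one_div] at h
    refine h.congr_deriv ?_
    simp
    field_simp
  refine deriv_deriv_pos_of_convexOn_sub analyticOnNhd_F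
    (p := fun s ↦ 1 / (2 - s) + 1 / (3 - s) - 5 / 32 * s ^ 2)
    (p' := fun s ↦ 1 / (2 - s) ^ 2 + 1 / (3 - s) ^ 2 - 5 / 16 * s)
    (p'' := fun s ↦ 2 / (2 - s) ^ 3 + 2 / (3 - s) ^ 3 - 5 / 16) ?_ ?_ ?_ ?_
  · intro s hs
    refine (((hinv 2 s (by linarith [hs.2])).add (hinv 3 s (by linarith [hs.2]))).sub
      ((hasDerivAt_pow 2 s).const_mul (5 / 32))).congr_deriv ?_
    norm_num
    ring
  · intro s hs
    refine (((hinv2 2 s (by linarith [hs.2])).add (hinv2 3 s (by linarith [hs.2]))).sub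
      ((hasDerivAt_id s).const_mul (5 / 16))).congr_deriv ?_
    simp
  · intro s hs
    have h2 : (2 : ℝ) / 2 ^ 3 ≤ 2 / (2 - s) ^ 3 := by
      have : 0 < 2 - s := by linarith [hs.2]
      gcongr
      linarith [hs.1]
    have h3 : (2 : ℝ) / 3 ^ 3 ≤ 2 / (3 - s) ^ 3 := by
      have : 0 < 3 - s := by linarith [hs.2]
      gcongr
      linarith [hs.1]
    norm_num at h2 h3
    linarith
  · have hdig : ConvexOn ℝ (Ioo (0 : ℝ) 1) fun s ↦ -digammaReal (4 - s) := by
      refine ⟨convex_Ioo 0 1, fun x hx y hy a b ha hb hab ↦ ?_⟩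
      have h := convexOn_neg_digammaReal.2 (x := 4 - x) (y := 4 - y)
        (by simp only [mem_Ioi]; linarith [hx.2]) (by simp only [mem_Ioi]; linarith [hy.2])
        ha hb hab
      simp only [smul_eq_mul] at h ⊢
      rwa [show a * (4 - x) + b * (4 - y) = 4 - (a * x + b * y) by linear_combination 4 * hab] at h
    refine ((convexOn_integral_trapezoidKernel.add hdig).add
      (convexOn_const (1 / 2) (convex_Ioo 0 1))).congr fun s hs ↦ ?_
    rw [F_eq hs]
    simp only [Pi.add_apply]
    ring

theorem stmt_15 :
    StrictConvexOn ℝ (Set.Ioo (0:ℝ) 1) F ∧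
      ∀ s ∈ Set.Ioo (0:ℝ) 1, 0 < deriv (deriv F) s := by
  refine ⟨?_, deriv_deriv_F_pos⟩
  refine strictConvexOn_of_deriv2_pos' (convex_Ioo 0 1) analyticOnNhd_F.continuousOn ?_
  simpa using deriv_deriv_F_pos
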